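/- Let (A⁺, v) be a semi-valuation ring with valuative ideal 𝔭 = v⁻¹(0) and semi-fraction ring A = A⁺_𝔭, and let λ : Spec A ⟶ Spec A⁺ denote the morphism of schemes induced by the localization map A⁺ → A. Let f : X ⟶ Spec A⁺ be a proper morphism of schemes and g : Spec A ⟶ X a morphism with g ≫ f = λ. Then f admits a section compatible with g: there exists a morphism s : Spec A⁺ ⟶ X such that s ≫ f = 𝟙_{Spec A⁺} and λ ≫ s = g. -/

import Mathlib

open CategoryTheory AlgebraicGeometry

universe u

/-- Temkin's notion of a semi-valuation ring: a valuation `v` on a commutative ring `A⁺`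
(`v 1 = 1`, `v (x*y) = v x * v y`, `v (x+y) ≤ max (v x) (v y)`, values in a linearly
ordered group with zero) such that
(i) every zero divisor of `A⁺` lies in the support `𝔭 = v⁻¹(0)` of `v`, and
(ii) for all `x y` with `v x ≤ v y ≠ 0` one has `y ∣ x`. -/
def IsSemiValuation {A : Type*} [CommRing A] {Γ : Type*}
    [LinearOrderedCommGroupWithZero Γ] (v : Valuation A Γ) : Prop :=
  (∀ x y : A, x * y = 0 → y ≠ 0 → v x = 0) ∧
  (∀ x y : A, v x ≤ v y → v y ≠ 0 → y ∣ x)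

namespace IsSemiValuation

variable {A : Type*} [CommRing A] {Γ : Type*} [LinearOrderedCommGroupWithZero Γ]
  {v : Valuation A Γ}

theorem injective_algebraMap (hv : IsSemiValuation v) :
    Function.Injective (algebraMap A (Localization.AtPrime v.supp)) := by
  refine IsLocalization.injective (M := v.supp.primeCompl) _ fun s hs ↦ ?_
  rw [mem_nonZeroDivisors_iff_right]
  intro x hx
  by_contra hx0
  exact hs (hv.1 s x (by rwa [mul_comm]) hx0)

theorem valuationRing_quotient_supp (hv : IsSemiValuation v) : ValuationRing (A ⧸ v.supp) := by
  refine ValuationRing.iff_dvd_total.mpr ⟨fun a b ↦ ?_⟩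
  obtain ⟨x, rfl⟩ := Ideal.Quotient.mk_surjective a
  obtain ⟨y, rfl⟩ := Ideal.Quotient.mk_surjective b
  by_cases hx : x ∈ v.supp
  · exact .inr (by rw [Ideal.Quotient.eq_zero_iff_mem.mpr hx]; exact dvd_zero _)
  by_cases hy : y ∈ v.supp
  · exact .inl (by rw [Ideal.Quotient.eq_zero_iff_mem.mpr hy]; exact dvd_zero _)
  rcases le_total (v x) (v y) with h | h
  · exact .inr (map_dvd _ (hv.2 _ _ h hy))
  · exact .inl (map_dvd _ (hv.2 _ _ h hx))

/-- The valuative ideal is already an ideal of the semi-fraction ring. -/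
theorem mem_range_of_mem_maximalIdeal (hv : IsSemiValuation v)
    {z : Localization.AtPrime v.supp} (hz : z ∈ IsLocalRing.maximalIdeal _) :
    z ∈ (algebraMap A (Localization.AtPrime v.supp)).range := by
  obtain ⟨x, s, rfl⟩ := IsLocalization.exists_mk'_eq v.supp.primeCompl z
  have hx : v x = 0 := (IsLocalization.AtPrime.mk'_mem_maximal_iff _ v.supp x s).mp hz
  obtain ⟨t, rfl⟩ := hv.2 x s (by rw [hx]; exact zero_le) s.2
  exact ⟨t, by rw [IsLocalization.eq_mk'_iff_mul_eq, ← map_mul, mul_comm]⟩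

/-- A semi-valuation ring is the fibre product of its semi-fraction ring and its quotient by the
valuative ideal over their common residue field. -/
theorem exists_lift_of_residue_eq (hv : IsSemiValuation v) {B : Type*} [CommRing B]
    (φ : B →+* Localization.AtPrime v.supp) (ψ : B →+* A ⧸ v.supp)
    (h : (IsLocalRing.residue _).comp φ = (algebraMap _ v.supp.ResidueField).comp ψ) :
    ∃ χ : B →+* A, (algebraMap A (Localization.AtPrime v.supp)).comp χ = φ := by
  have hφ (b : B) : φ b ∈ (algebraMap A (Localization.AtPrime v.supp)).range := by
    obtain ⟨a, ha⟩ := Ideal.Quotient.mk_surjective (ψ b)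
    rw [← sub_add_cancel (φ b) (algebraMap A _ a)]
    refine add_mem (hv.mem_range_of_mem_maximalIdeal ?_) ⟨a, rfl⟩
    have hb := RingHom.congr_fun h b
    rw [RingHom.comp_apply, RingHom.comp_apply, ← ha,
      Ideal.algebraMap_quotient_residueField_mk] at hb
    rw [← IsLocalRing.residue_eq_zero_iff, map_sub, hb, sub_eq_zero]
    rfl
  let e := (algebraMap A (Localization.AtPrime v.supp)).rangeRestrict
  have he : Function.Bijective e :=
    ⟨fun x y hxy ↦ hv.injective_algebraMap (congrArg Subtype.val hxy),
      RingHom.rangeRestrict_surjective _⟩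
  refine ⟨(RingEquiv.ofBijective e he).symm.toRingHom.comp (φ.codRestrict _ hφ), ?_⟩
  ext b
  exact congrArg Subtype.val ((RingEquiv.ofBijective e he).apply_symm_apply ⟨φ b, hφ b⟩)

end IsSemiValuation

/-- The image of the spectrum of a local ring lies in the range of every open immersion that
contains the image of the closed point. -/
theorem range_subset_of_closedPoint_mem {R : CommRingCat.{u}} [IsLocalRing R] {X U : Scheme.{u}}
    (f : Spec R ⟶ X) (j : U ⟶ X) [IsOpenImmersion j]
    (h : f (IsLocalRing.closedPoint R) ∈ Set.range j) : Set.range f ⊆ Set.range j := by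
  rintro _ ⟨x, rfl⟩
  exact ((IsLocalRing.specializes_closedPoint x).map f.continuous).mem_open
    j.isOpenEmbedding.isOpen_range h

/-- Let `(A⁺, v)` be a semi-valuation ring with valuative ideal
`𝔭 = v.supp` and semi-fraction ring `A = A⁺_𝔭`, and let `λ : Spec A ⟶ Spec A⁺` be
induced by the localization map. For every proper morphism `f : X ⟶ Spec A⁺` and every
morphism `g : Spec A ⟶ X` with `g ≫ f = λ`, there is a section `s : Spec A⁺ ⟶ X` of `f`
with `s ≫ f = 𝟙` and `λ ≫ s = g`. -/
theorem proper_section_of_semiValuation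
    {Ap : Type u} [CommRing Ap] {Γ : Type*} [LinearOrderedCommGroupWithZero Γ]
    (v : Valuation Ap Γ) (hv : IsSemiValuation v)
    (X : Scheme.{u}) (f : X ⟶ Spec (CommRingCat.of Ap)) [IsProper f]
    (g : Spec (CommRingCat.of (Localization.AtPrime v.supp)) ⟶ X)
    (hg : g ≫ f = Spec.map (CommRingCat.ofHom
      (algebraMap Ap (Localization.AtPrime v.supp)))) :
    ∃ s : Spec (CommRingCat.of Ap) ⟶ X,
      s ≫ f = 𝟙 (Spec (CommRingCat.of Ap)) ∧
      Spec.map (CommRingCat.ofHom (algebraMap Ap (Localization.AtPrime v.supp))) ≫ s = g := by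
  suffices h : ∃ s : Spec (CommRingCat.of Ap) ⟶ X,
      Spec.map (CommRingCat.ofHom (algebraMap Ap (Localization.AtPrime v.supp))) ≫ s = g by
    obtain ⟨s, hs⟩ := h
    refine ⟨s, ?_, hs⟩
    obtain ⟨α, hα⟩ := Spec.map_surjective (s ≫ f)
    rw [← hs, Category.assoc, ← hα, ← Spec.map_comp] at hg
    have hα' := Spec.map_injective hg
    rw [← hα, ← Spec.map_id]
    congr 1
    ext a
    exact hv.injective_algebraMap (RingHom.congr_fun (congrArg CommRingCat.Hom.hom hα') a)
  have := hv.valuationRing_quotient_supp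
  let res : CommRingCat.of (Localization.AtPrime v.supp) ⟶ CommRingCat.of v.supp.ResidueField :=
    CommRingCat.ofHom (IsLocalRing.residue _)
  let incl : CommRingCat.of (Ap ⧸ v.supp) ⟶ CommRingCat.of v.supp.ResidueField :=
    CommRingCat.ofHom (algebraMap _ _)
  have sq : CommSq (Spec.map res ≫ g) (Spec.map incl) f
      (Spec.map (CommRingCat.ofHom (Ideal.Quotient.mk v.supp))) := by
    constructor
    rw [Category.assoc, hg, ← Spec.map_comp, ← Spec.map_comp]
    rfl
  have hlift : sq.HasLift :=
    ((IsProper.eq_valuativeCriterion.le _ _ f inferInstance).1.1.1.existence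
      ⟨Ap ⧸ v.supp, v.supp.ResidueField, _, _, sq⟩)
  let l := sq.lift
  have hl : Spec.map incl ≫ l = Spec.map res ≫ g := sq.fac_left
  obtain ⟨B, j, hj, b, hb⟩ := Scheme.exists_Spec_apply_eq (l (IsLocalRing.closedPoint _))
  have hlj : Set.range l ⊆ Set.range j := range_subset_of_closedPoint_mem l j ⟨b, hb⟩
  have hgj : Set.range g ⊆ Set.range j := by
    refine range_subset_of_closedPoint_mem g j ?_
    let y : Spec (CommRingCat.of v.supp.ResidueField) :=
      IsLocalRing.closedPoint v.supp.ResidueField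
    have hy : Spec.map res y = IsLocalRing.closedPoint (Localization.AtPrime v.supp) :=
      IsLocalRing.comap_closedPoint (IsLocalRing.residue (Localization.AtPrime v.supp))
    have hgy : g (Spec.map res y) ∈ Set.range j := by
      rw [← Scheme.Hom.comp_apply, ← hl, Scheme.Hom.comp_apply]
      exact hlj ⟨_, rfl⟩
    exact hy ▸ hgy
  obtain ⟨φ, hφ⟩ := Spec.map_surjective (IsOpenImmersion.lift j g hgj)
  obtain ⟨ψ, hψ⟩ := Spec.map_surjective (IsOpenImmersion.lift j l hlj)
  have hφψ : φ ≫ res = ψ ≫ incl := by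
    apply Spec.map_injective
    rw [Spec.map_comp, Spec.map_comp, hφ, hψ, ← cancel_mono j, Category.assoc, Category.assoc,
      IsOpenImmersion.lift_fac, IsOpenImmersion.lift_fac, hl]
  obtain ⟨χ, hχ⟩ := hv.exists_lift_of_residue_eq φ.hom ψ.hom 
    (congrArg CommRingCat.Hom.hom hφψ)
  refine ⟨Spec.map (CommRingCat.ofHom χ) ≫ j, ?_⟩
  rw [← Category.assoc, ← Spec.map_comp, ← CommRingCat.ofHom_comp, hχ, CommRingCat.ofHom_hom, hφ,
    IsOpenImmersion.lift_fac]
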